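/- arXiv:2503.16757 — 12 statements merged into one kernel-verified Lean document; each statement's English description precedes it below -/
import Mathlib

section
/- Let X be a compact metric space, f : X → X a homeomorphism and μ a Borel probability measure on X. Then f is μ-expansive if and only if there exists δ > 0 such that μ(Γ_δ(x)) = 0 for μ-almost every x ∈ X. -/
open MeasureTheory Set Filter

/-- `Γ_δ(x)` for a bijection `f`: points whose full orbit stays `δ`-close to that of `x`. -/
def Gamma {X : Type*} [MetricSpace X] (f : Equiv.Perm X) (δ : ℝ) (x : X) : Set X :=
  {y | ∀ n : ℤ, dist ((f ^ n) x) ((f ^ n) y) ≤ δ}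

/-- `f` is `μ`-expansive. -/
def MeasureExpansive {X : Type*} [MetricSpace X] [MeasurableSpace X]
    (μ : Measure X) (f : Equiv.Perm X) : Prop :=
  ∃ δ > (0 : ℝ), ∀ x : X, μ (Gamma f δ x) = 0

/-- If `y ∈ Γ_{δ/2}(x)` then `Γ_{δ/2}(x) ⊆ Γ_δ(y)`. -/
lemma Gamma_half_subset_of_mem {X : Type*} [MetricSpace X] (f : Equiv.Perm X) {δ : ℝ} {x y : X}
    (hy : y ∈ Gamma f (δ / 2) x) : Gamma f (δ / 2) x ⊆ Gamma f δ y := fun _ hz n =>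
  (dist_triangle_left _ _ _).trans ((add_le_add (hy n) (hz n)).trans_eq (add_halves δ))

theorem measureExpansive_iff_ae {X : Type*} [MetricSpace X] [CompactSpace X]
    [MeasurableSpace X] [BorelSpace X] (f : X ≃ₜ X)
    (μ : Measure X) [IsProbabilityMeasure μ] :
    MeasureExpansive μ f.toEquiv ↔
      ∃ δ > (0 : ℝ), ∀ᵐ x ∂μ, μ (Gamma f.toEquiv δ x) = 0 := by
  constructor
  · rintro ⟨δ, hδ, h⟩
    exact ⟨δ, hδ, Eventually.of_forall h⟩
  · rintro ⟨δ, hδ, h⟩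
    refine ⟨δ / 2, half_pos hδ, fun x => ?_⟩
    by_contra hx
    obtain ⟨y, hy, hy0⟩ := ((frequently_ae_mem_iff.2 hx).and_eventually h).exists
    exact hx (measure_mono_null (Gamma_half_subset_of_mem _ hy) hy0)
end

section
/- Let X be a compact metric space, f : X → X a homeomorphism and μ a Borel probability measure on X. Then f is μ-expansive if and only if there exists δ > 0 such that μ(Γ_δ(x)) = 0 for all x in the support of μ. -/
open MeasureTheory Set Filter

/-- The support of a measure: points all of whose open neighborhoods have positive measure. -/
def measSupport {X : Type*} [MetricSpace X] [MeasurableSpace X] (μ : Measure X) : Set X :=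
  {x | ∀ U : Set X, IsOpen U → x ∈ U → 0 < μ U}

lemma measSupport_eq_support {X : Type*} [MetricSpace X] [MeasurableSpace X] (μ : Measure X) :
    measSupport μ = μ.support := by
  rw [Measure.support_eq_forall_isOpen]
  ext x
  exact forall_congr' fun U => ⟨fun h hx hU => h hU hx, fun h hU hx => h hx hU⟩

lemma Gamma_half_subset_Gamma {X : Type*} [MetricSpace X] {f : Equiv.Perm X} {δ : ℝ} {x y : X}
    (hy : y ∈ Gamma f (δ / 2) x) : Gamma f (δ / 2) x ⊆ Gamma f δ y := fun z hz n => by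
  linarith [dist_triangle_left ((f ^ n) y) ((f ^ n) z) ((f ^ n) x), hy n, hz n]

theorem measureExpansive_iff_support {X : Type*} [MetricSpace X] [CompactSpace X]
    [MeasurableSpace X] [BorelSpace X] (f : X ≃ₜ X)
    (μ : Measure X) [IsProbabilityMeasure μ] :
    MeasureExpansive μ f.toEquiv ↔
      ∃ δ > (0 : ℝ), ∀ x ∈ measSupport μ, μ (Gamma f.toEquiv δ x) = 0 := by
  refine ⟨fun ⟨δ, hδ, h⟩ => ⟨δ, hδ, fun x _ => h x⟩, fun ⟨δ, hδ, h⟩ =>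
    ⟨δ / 2, half_pos hδ, fun x => ?_⟩⟩
  by_contra hx
  obtain ⟨y, hy, hys⟩ := Measure.nonempty_inter_support_of_pos (pos_iff_ne_zero.mpr hx)
  rw [← measSupport_eq_support] at hys
  exact hx (measure_mono_null (Gamma_half_subset_Gamma hy) (h y hys))
end

section
/- Let X be a compact metric space, f : X → X a homeomorphism, μ a Borel probability measure on X, and n a nonzero integer. Then f is μ-expansive if and only if f^n is μ-expansive. -/
open MeasureTheory Set Filter

open Uniformity in
/-- On a compact space, `δ`-closeness of full orbits under a homeomorphism follows from
`ε`-closeness along the orbits of a nonzero power. -/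
lemma exists_Gamma_zpow_subset {X : Type*} [MetricSpace X] [CompactSpace X] (f : X ≃ₜ X)
    {n : ℤ} (hn : n ≠ 0) {δ : ℝ} (hδ : 0 < δ) :
    ∃ ε > 0, ∀ x, Gamma (f.toEquiv ^ n) ε x ⊆ Gamma f.toEquiv δ x := by
  have hcont (r : ℕ) : UniformContinuous ⇑(f.toEquiv ^ r) := by
    refine CompactSpace.uniformContinuous_of_continuous ?_
    rw [Equiv.Perm.coe_pow]
    exact f.continuous.iterate r
  have hev : ∀ᶠ p in 𝓤 X, ∀ r ∈ Finset.range n.natAbs,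
      dist ((f.toEquiv ^ r) p.1) ((f.toEquiv ^ r) p.2) < δ :=
    (Filter.eventually_all_finset _).2 fun r _ ↦ hcont r (Metric.dist_mem_uniformity hδ)
  obtain ⟨ε, hε, h⟩ := Metric.mem_uniformity_dist.1 hev
  refine ⟨ε / 2, half_pos hε, fun x y hy m ↦ ?_⟩
  have hlt : (m % n).toNat < n.natAbs := by
    have := Int.emod_lt_abs m hn
    rw [Int.abs_eq_natAbs] at this
    have := Int.emod_nonneg m hn
    omega
  have hdecomp : f.toEquiv ^ m = f.toEquiv ^ (m % n).toNat * (f.toEquiv ^ n) ^ (m / n) := by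
    rw [← zpow_natCast, Int.toNat_of_nonneg (Int.emod_nonneg m hn), ← zpow_mul, ← zpow_add,
      Int.emod_add_mul_ediv]
  rw [hdecomp]
  exact (h ((hy (m / n)).trans_lt (half_lt_self hε)) _ (Finset.mem_range.2 hlt)).le

lemma Gamma_subset_Gamma_zpow {X : Type*} [MetricSpace X] (f : Equiv.Perm X) (n : ℤ) (δ : ℝ)
    (x : X) : Gamma f δ x ⊆ Gamma (f ^ n) δ x := fun y hy k ↦ by
  simpa only [← zpow_mul] using hy (n * k)

theorem measureExpansive_iff_zpow {X : Type*} [MetricSpace X] [CompactSpace X]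
    [MeasurableSpace X] [BorelSpace X] (f : X ≃ₜ X)
    (μ : Measure X) [IsProbabilityMeasure μ] (n : ℤ) (hn : n ≠ 0) :
    MeasureExpansive μ f.toEquiv ↔ MeasureExpansive μ (f.toEquiv ^ n) := by
  constructor
  · rintro ⟨δ, hδ, h⟩
    obtain ⟨ε, hε, hsub⟩ := exists_Gamma_zpow_subset f hn hδ
    exact ⟨ε, hε, fun x ↦ measure_mono_null (hsub x) (h x)⟩
  · rintro ⟨δ, hδ, h⟩
    exact ⟨δ, hδ, fun x ↦ measure_mono_null (Gamma_subset_Gamma_zpow _ n δ x) (h x)⟩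
end

section
/- Let X be a compact metric space, f : X → X a homeomorphism and μ a Borel probability measure on X. Then f is μ-expansive if and only if there exists a compact neighborhood U of the diagonal Δ = {(x,x) : x ∈ X} in X × X such that (μ × μ)({z ∈ X × X : (f × f)^n(z) ∈ U for all n ∈ ℤ}) = 0. -/
open MeasureTheory Set Filter

theorem Homeomorph.continuous_toEquiv_zpow {X : Type*} [TopologicalSpace X] (f : X ≃ₜ X) (n : ℤ) :
    Continuous (f.toEquiv ^ n : Equiv.Perm X) := by
  cases n with
  | ofNat n =>
    rw [Int.ofNat_eq_natCast, zpow_natCast, ← Equiv.Perm.iterate_eq_pow]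
    exact f.continuous.iterate n
  | negSucc n =>
    rw [zpow_negSucc, ← inv_pow, ← Equiv.Perm.iterate_eq_pow]
    exact f.symm.continuous.iterate (n + 1)

theorem dist_zpow_le_of_mem_Gamma {X : Type*} [MetricSpace X] {f : Equiv.Perm X} {δ : ℝ}
    {x y z : X} (hy : y ∈ Gamma f δ x) (hz : z ∈ Gamma f δ x) (n : ℤ) :
    dist ((f ^ n) y) ((f ^ n) z) ≤ δ + δ :=
  (dist_triangle_left _ _ ((f ^ n) x)).trans (add_le_add (hy n) (hz n))

theorem measureExpansive_iff_diagonal_isolated {X : Type*} [MetricSpace X] [CompactSpace X]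
    [MeasurableSpace X] [BorelSpace X] (f : X ≃ₜ X)
    (μ : Measure X) [IsProbabilityMeasure μ] :
    MeasureExpansive μ f.toEquiv ↔
      ∃ U : Set (X × X), IsCompact U ∧ Set.diagonal X ⊆ interior U ∧
        (μ.prod μ) {z : X × X |
          ∀ n : ℤ, ((f.toEquiv ^ n) z.1, (f.toEquiv ^ n) z.2) ∈ U} = 0 := by
  constructor
  · rintro ⟨δ, hδ, hnull⟩
    have hU : IsClosed {z : X × X | dist z.1 z.2 ≤ δ} :=
      isClosed_le continuous_dist continuous_const
    refine ⟨{z | dist z.1 z.2 ≤ δ}, hU.isCompact, ?_, ?_⟩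
    · rw [subset_interior_iff_mem_nhdsSet, nhdsSet_diagonal_eq_uniformity]
      exact mem_of_superset (Metric.dist_mem_uniformity hδ) fun z (hz : dist z.1 z.2 < δ) => hz.le
    · have : SecondCountableTopology X := UniformSpace.secondCountable_of_separable X
      have hclosed : IsClosed {z : X × X | ∀ n : ℤ,
          ((f.toEquiv ^ n) z.1, (f.toEquiv ^ n) z.2) ∈ {z : X × X | dist z.1 z.2 ≤ δ}} := by
        rw [ofPred_forall]
        refine isClosed_iInter fun n => hU.preimage ?_
        have hf := f.continuous_toEquiv_zpow n
        exact (hf.comp continuous_fst).prodMk (hf.comp continuous_snd)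
      rw [Measure.measure_prod_null hclosed.measurableSet]
      exact Eventually.of_forall hnull
  · rintro ⟨U, -, hU, hnull⟩
    rw [subset_interior_iff_mem_nhdsSet, nhdsSet_diagonal_eq_uniformity] at hU
    obtain ⟨ε, hε, hεU⟩ := Metric.mem_uniformity_dist.1 hU
    refine ⟨ε / 3, by positivity, fun x => ?_⟩
    have hprod : (μ.prod μ) (Gamma f.toEquiv (ε / 3) x ×ˢ Gamma f.toEquiv (ε / 3) x) = 0 :=
      measure_mono_null (fun z hz n => hεU <|
        (dist_zpow_le_of_mem_Gamma hz.1 hz.2 n).trans_lt (by linarith)) hnull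
    rwa [Measure.prod_prod, mul_self_eq_zero] at hprod
end

section
/- Let X be a compact metric space, f : X → X a homeomorphism and μ a Borel probability measure on X. Then f is μ-expansive if and only if f has a μ-generator, i.e., a finite open cover 𝒜 of X such that for every bisequence (A_n)_{n∈ℤ} of members of 𝒜 one has μ(⋂_{n∈ℤ} f^n(cl(A_n))) = 0. -/
open MeasureTheory Set Filter

/-- A `μ`-generator of `f`: a finite open cover `𝒜` such that for every bisequence of
members of `𝒜` the intersection `⋂_{n ∈ ℤ} fⁿ(cl(Aₙ))` is `μ`-null. -/
def IsMuGenerator {X : Type*} [MetricSpace X] [MeasurableSpace X]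
    (μ : Measure X) (f : Equiv.Perm X) (𝒜 : Finset (Set X)) : Prop :=
  (∀ A ∈ 𝒜, IsOpen A) ∧ (⋃ A ∈ 𝒜, A) = Set.univ ∧
    ∀ A : ℤ → Set X, (∀ n : ℤ, A n ∈ 𝒜) →
      μ (⋂ n : ℤ, (f ^ n) '' closure (A n)) = 0

theorem mem_image_perm_zpow_iff {X : Type*} (f : Equiv.Perm X) (n : ℤ) (s : Set X) (y : X) :
    y ∈ (f ^ n) '' s ↔ (f ^ (-n)) y ∈ s := by
  rw [Equiv.image_eq_preimage_symm, zpow_neg]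
  rfl

theorem MeasureExpansive.exists_isMuGenerator {X : Type*} [MetricSpace X] [CompactSpace X]
    [MeasurableSpace X] {μ : Measure X} {f : Equiv.Perm X} (h : MeasureExpansive μ f) :
    ∃ 𝒜 : Finset (Set X), IsMuGenerator μ f 𝒜 := by
  classical
  obtain ⟨δ, hδ, hμ⟩ := h
  obtain ⟨t, ht⟩ := isCompact_univ.elim_finite_subcover (fun x : X => Metric.ball x (δ / 2))
    (fun _ => Metric.isOpen_ball)
    (fun x _ => mem_iUnion.2 ⟨x, Metric.mem_ball_self (half_pos hδ)⟩)
  refine ⟨t.image fun x => Metric.ball x (δ / 2), ?_, ?_, fun A hA => ?_⟩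
  · intro A hA
    obtain ⟨x, -, rfl⟩ := Finset.mem_image.1 hA
    exact Metric.isOpen_ball
  · rw [Finset.set_biUnion_finset_image]
    exact univ_subset_iff.1 ht
  · rcases (⋂ n : ℤ, (f ^ n) '' closure (A n)).eq_empty_or_nonempty with he | ⟨x, hx⟩
    · rw [he, measure_empty]
    · refine measure_mono_null (t := Gamma f δ x) (fun y hy n => ?_) (hμ x)
      have hx' := (mem_image_perm_zpow_iff f _ _ _).1 (mem_iInter.1 hx (-n))
      have hy' := (mem_image_perm_zpow_iff f _ _ _).1 (mem_iInter.1 hy (-n))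
      obtain ⟨c, -, hc⟩ := Finset.mem_image.1 (hA (-n))
      rw [neg_neg, ← hc] at hx' hy'
      have hxc := Metric.mem_closedBall.1 (Metric.closure_ball_subset_closedBall hx')
      have hyc := Metric.mem_closedBall.1 (Metric.closure_ball_subset_closedBall hy')
      linarith [dist_triangle_right ((f ^ n) x) ((f ^ n) y) c]

theorem IsMuGenerator.measureExpansive {X : Type*} [MetricSpace X] [CompactSpace X]
    [MeasurableSpace X] {μ : Measure X} {f : Equiv.Perm X} {𝒜 : Finset (Set X)}
    (h : IsMuGenerator μ f 𝒜) : MeasureExpansive μ f := by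
  obtain ⟨ho, hcover, hμ⟩ := h
  obtain ⟨δ, hδ, hball⟩ := lebesgue_number_lemma_of_metric_sUnion isCompact_univ
    (c := (𝒜 : Set (Set X))) ho (by rw [sUnion_eq_biUnion]; exact hcover.ge)
  refine ⟨δ / 2, half_pos hδ, fun x => ?_⟩
  choose A hA hsub using fun n : ℤ => hball ((f ^ (-n)) x) (mem_univ _)
  refine measure_mono_null (fun y hy => mem_iInter.2 fun n => ?_) (hμ A hA)
  refine (mem_image_perm_zpow_iff f _ _ _).2 (subset_closure (hsub n ?_))
  rw [Metric.mem_ball, dist_comm]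
  exact (hy (-n)).trans_lt (half_lt_self hδ)

theorem measureExpansive_iff_muGenerator {X : Type*} [MetricSpace X] [CompactSpace X]
    [MeasurableSpace X] [BorelSpace X] (f : X ≃ₜ X)
    (μ : Measure X) [IsProbabilityMeasure μ] :
    MeasureExpansive μ f.toEquiv ↔ ∃ 𝒜 : Finset (Set X), IsMuGenerator μ f.toEquiv 𝒜 :=
  ⟨fun h => h.exists_isMuGenerator, fun ⟨_, h⟩ => h.measureExpansive⟩
end

section
/- Let X be a compact metric space and f : X → X a homeomorphism. Then there exists a countable subset D of Fix(f) such that A(f) = ⋂_{n≥1} ⋃_{(x,y)∈D×D} A(x,y,n), where A(f) denotes the set of points with converging semi-orbits under f. -/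
open MeasureTheory Set Filter

/-- `A(x,y,n,m)`: points `z` with `d(fⁱz, x) ≤ 1/n` for all `i ≤ -m` and
`d(fʲz, y) ≤ 1/n` for all `j ≥ m`. -/
def Aset {X : Type*} [MetricSpace X] (f : Equiv.Perm X) (x y : X) (n m : ℕ) : Set X :=
  {z | (∀ i : ℤ, i ≤ -(m : ℤ) → dist ((f ^ i) z) x ≤ 1 / n) ∧
       (∀ j : ℤ, (m : ℤ) ≤ j → dist ((f ^ j) z) y ≤ 1 / n)}

/-- `A(x,y,n) = ⋃_{m ∈ ℕ} A(x,y,n,m)`. -/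
def AsetU {X : Type*} [MetricSpace X] (f : Equiv.Perm X) (x y : X) (n : ℕ) : Set X :=
  ⋃ m : ℕ, Aset f x y n m

/-- The set `A(f)` of points with converging semi-orbits under `f`. -/
def convergingSemiOrbits {X : Type*} [MetricSpace X] (f : X ≃ₜ X) : Set X :=
  {z | (∃ q : X, Tendsto (fun k : ℕ => (f.toEquiv ^ (k : ℤ)) z) atTop (nhds q)) ∧
       (∃ p : X, Tendsto (fun k : ℕ => (f.toEquiv ^ (-(k : ℤ))) z) atTop (nhds p))}

lemma exists_tendsto_of_forall_eventually_dist_le {X : Type*} [PseudoMetricSpace X]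
    [CompleteSpace X] {u : ℕ → X}
    (h : ∀ n : ℕ, 1 ≤ n → ∃ x, ∃ m, ∀ k, m ≤ k → dist (u k) x ≤ 1 / n) :
    ∃ p, Tendsto u atTop (nhds p) := by
  apply cauchySeq_tendsto_of_complete
  rw [Metric.cauchySeq_iff']
  intro ε hε
  obtain ⟨n, hn⟩ := exists_nat_one_div_lt (half_pos hε)
  obtain ⟨x, m, hm⟩ := h (n + 1) (Nat.le_add_left 1 n)
  push_cast at hm
  refine ⟨m, fun k hk => ?_⟩
  have hkx := hm k hk
  have hmx := hm m le_rfl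
  have htri := dist_triangle_right (u k) (u m) x
  linarith

lemma exists_mem_eventually_dist_le {X : Type*} [PseudoMetricSpace X] {u : ℕ → X} {p : X}
    {D : Set X} (hu : Tendsto u atTop (nhds p)) (hp : p ∈ closure D) {ε : ℝ} (hε : 0 < ε) :
    ∃ x ∈ D, ∀ᶠ k in atTop, dist (u k) x ≤ ε := by
  obtain ⟨x, hx, hpx⟩ := Metric.mem_closure_iff.1 hp ε hε
  exact ⟨x, hx, (hu.dist tendsto_const_nhds).eventually_le_const hpx⟩

theorem convergingSemiOrbits_eq_iInter_iUnion {X : Type*} [MetricSpace X] [CompactSpace X]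
    (f : X ≃ₜ X) :
    ∃ D : Set X, D.Countable ∧ D ⊆ {x : X | f x = x} ∧
      convergingSemiOrbits f =
        ⋂ (n : ℕ) (_ : 1 ≤ n), ⋃ (x ∈ D) (y ∈ D), AsetU f.toEquiv x y n := by
  obtain ⟨D, hDs, hDc, hD⟩ :=
    (TopologicalSpace.IsSeparable.of_separableSpace
      {x : X | f x = x}).exists_countable_dense_subset
  refine ⟨D, hDc, hDs, ?_⟩
  have apply_zpow (k : ℤ) (z : X) : f ((f.toEquiv ^ k) z) = (f.toEquiv ^ (1 + k)) z := by
    rw [zpow_add, zpow_one]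
    rfl
  ext z
  simp only [mem_iInter, mem_iUnion, AsetU, exists_prop]
  constructor
  · rintro ⟨⟨q, hq⟩, ⟨p, hp⟩⟩ n hn
    have hfq : f q = q := by
      refine tendsto_nhds_unique ((f.continuous.tendsto q).comp hq)
        ((hq.comp (tendsto_add_atTop_nat 1)).congr fun k => ?_)
      simp only [Function.comp_apply, apply_zpow]
      congr 2
      push_cast
      ring
    have hfp : f p = p := by
      refine tendsto_nhds_unique
        ((f.continuous.tendsto p).comp (hp.comp (tendsto_add_atTop_nat 1)))
        (hp.congr fun k => ?_)
      simp only [Function.comp_apply, apply_zpow]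
      congr 2
      push_cast
      ring
    have hpos : (0 : ℝ) < 1 / n := by positivity
    obtain ⟨x, hx, hpx⟩ := exists_mem_eventually_dist_le hp (hD hfp) hpos
    obtain ⟨y, hy, hqy⟩ := exists_mem_eventually_dist_le hq (hD hfq) hpos
    obtain ⟨m, hm⟩ := eventually_atTop.1 (hpx.and hqy)
    refine ⟨x, hx, y, hy, m, fun i hi => ?_, fun j hj => ?_⟩
    · obtain ⟨k, rfl⟩ : ∃ k : ℕ, i = -(k : ℤ) := ⟨i.natAbs, by omega⟩
      exact (hm k (by omega)).1
    · lift j to ℕ using by omega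
      exact (hm j (by omega)).2
  · intro h
    constructor
    · refine exists_tendsto_of_forall_eventually_dist_le fun n hn => ?_
      obtain ⟨x, -, y, -, m, -, hm⟩ := h n hn
      exact ⟨y, m, fun k hk => hm k (by omega)⟩
    · refine exists_tendsto_of_forall_eventually_dist_le fun n hn => ?_
      obtain ⟨x, -, y, -, m, hm, -⟩ := h n hn
      exact ⟨x, m, fun k hk => hm (-k) (by omega)⟩
end

section
/- Let X be a compact metric space, μ a Borel probability measure on X, and f : X → X a μ-expansive homeomorphism. Then the set Per(f) of periodic points of f has μ-measure 0. -/
open MeasureTheory Set Filter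

/-- The set of periodic points of `f`. -/
def periodicPts {X : Type*} (f : X → X) : Set X :=
  {x | ∃ n : ℕ, 0 < n ∧ f^[n] x = x}

theorem Equiv.Perm.zpow_apply_eq_zpow_emod {X : Type*} (g : Equiv.Perm X) {n : ℕ} {x : X}
    (hx : (g ^ n) x = x) (k : ℤ) : (g ^ k) x = (g ^ (k % n)) x := by
  have h : g ^ k = g ^ (k % n) * (g ^ n) ^ (k / n) := by
    rw [← zpow_natCast, ← zpow_mul, ← zpow_add, Int.emod_add_mul_ediv]
  rw [h, Equiv.Perm.mul_apply, Equiv.Perm.zpow_apply_eq_self_of_apply_eq_self hx]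

theorem Homeomorph.continuous_toEquiv_pow {X : Type*} [TopologicalSpace X] (f : X ≃ₜ X) (n : ℕ) :
    Continuous ((f.toEquiv : Equiv.Perm X) ^ n) := by
  rw [Equiv.Perm.coe_pow]
  exact f.continuous.iterate n

/-- Among the points fixed by `f^n`, all points near `x` lie in `Γ_δ(x)`. -/
theorem Gamma_mem_nhdsWithin_fixedPoints {X : Type*} [MetricSpace X] (f : X ≃ₜ X) {n : ℕ}
    (hn : 0 < n) {δ : ℝ} (hδ : 0 < δ) {x : X} (hx : f^[n] x = x) :
    Gamma f.toEquiv δ x ∈ nhdsWithin x {y | f^[n] y = y} := by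
  have near : ∀ᶠ y in nhds x, ∀ i ∈ Iio n,
      dist (((f.toEquiv : Equiv.Perm X) ^ i) y) (((f.toEquiv : Equiv.Perm X) ^ i) x) < δ :=
    (eventually_all_finite (finite_Iio n)).2 fun i _ =>
      Metric.tendsto_nhds.1 (f.continuous_toEquiv_pow i).continuousAt δ hδ
  have fixed : ∀ y, f^[n] y = y → ((f.toEquiv : Equiv.Perm X) ^ n) y = y := fun y hy => by
    rw [Equiv.Perm.coe_pow]
    exact hy
  filter_upwards [mem_nhdsWithin_of_mem_nhds near, self_mem_nhdsWithin] with y hy hyn k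
  rw [Equiv.Perm.zpow_apply_eq_zpow_emod _ (fixed x hx),
    Equiv.Perm.zpow_apply_eq_zpow_emod _ (fixed y hyn), dist_comm]
  obtain ⟨i, hi⟩ := Int.eq_ofNat_of_zero_le (Int.emod_nonneg k (by omega : (n : ℤ) ≠ 0))
  have hin : i < n := by
    have := Int.emod_lt_of_pos k (by omega : (0 : ℤ) < n)
    omega
  rw [hi, zpow_natCast]
  exact (hy i hin).le

theorem measure_periodicPts_eq_zero {X : Type*} [MetricSpace X] [CompactSpace X]
    [MeasurableSpace X] [BorelSpace X] (μ : Measure X) [IsProbabilityMeasure μ]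
    (f : X ≃ₜ X) (hf : MeasureExpansive μ f.toEquiv) :
    μ (periodicPts ⇑f) = 0 := by
  obtain ⟨δ, hδ, hΓ⟩ := hf
  have hUnion : periodicPts f = ⋃ n : ℕ, {x | 0 < n ∧ f^[n] x = x} := by
    ext x
    simp [periodicPts]
  rw [hUnion, measure_iUnion_null_iff]
  intro n
  rcases Nat.eq_zero_or_pos n with rfl | hn
  · simp
  · simp only [hn, true_and]
    exact measure_null_of_locally_null _ fun x hx =>
      ⟨_, Gamma_mem_nhdsWithin_fixedPoints f hn hδ hx, hΓ x⟩
end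

section
/- Let S¹ be the unit circle in the complex plane with the induced metric, f : S¹ → S¹ a homeomorphism and μ a Borel probability measure on S¹. If f is μ-expansive, then f is not topologically conjugate to a rotation; that is, there are no homeomorphism h : S¹ → S¹ and complex number a with |a| = 1 such that f(z) = h(a · h⁻¹(z)) for all z ∈ S¹. -/
open MeasureTheory Set Filter

noncomputable instance : MeasurableSpace Circle := borel Circle
instance : BorelSpace Circle := ⟨rfl⟩

/-- If `f` is conjugate, by a homeomorphism of a compact metric space, to an isometry, then each
`Γ_δ(x)` with `δ > 0` is a neighbourhood of `x`. -/
theorem Gamma_mem_nhds_of_conj_isometry {X : Type*} [MetricSpace X] [CompactSpace X]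
    (f : Equiv.Perm X) (h : X ≃ₜ X) (g : X ≃ᵢ X) (hfg : ∀ x, f x = h (g (h.symm x)))
    {δ : ℝ} (hδ : 0 < δ) (x : X) : Gamma f δ x ∈ nhds x := by
  have hf : f = h.toEquiv.permCongrHom g.toEquiv := Equiv.ext hfg
  have hpow (n : ℤ) (y : X) : (f ^ n) y = h ((g ^ n) (h.symm y)) := by
    have hg : (g ^ n).toEquiv = (g.toEquiv : Equiv.Perm X) ^ n :=
      map_zpow (⟨⟨fun e => e.toEquiv, rfl⟩, fun _ _ => rfl⟩ : (X ≃ᵢ X) →* Equiv.Perm X) g n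
    rw [hf, ← map_zpow, ← hg]
    rfl
  have huc : UniformContinuous h := CompactSpace.uniformContinuous_of_continuous h.continuous
  obtain ⟨ε, hε, hh⟩ := Metric.uniformContinuous_iff.1 huc δ hδ
  filter_upwards [h.symm.continuous.continuousAt.preimage_mem_nhds
    (Metric.ball_mem_nhds (h.symm x) hε)] with y hy n
  rw [hpow, hpow]
  refine (hh ?_).le
  rw [(g ^ n).isometry.dist_eq, dist_comm]
  exact hy

/-- A measure-expansive map of a compact metric space, for a nonzero measure, is not conjugate to
an isometry. -/
theorem MeasureExpansive.not_conj_isometry {X : Type*} [MetricSpace X] [CompactSpace X]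
    [MeasurableSpace X] {μ : Measure X} [NeZero μ] {f : Equiv.Perm X}
    (hf : MeasureExpansive μ f) (h : X ≃ₜ X) (g : X ≃ᵢ X) :
    ¬ ∀ x, f x = h (g (h.symm x)) := by
  intro hfg
  obtain ⟨δ, hδ, hnull⟩ := hf
  have huniv : μ univ = 0 := measure_null_of_locally_null univ fun x _ =>
    ⟨Gamma f δ x, mem_nhdsWithin_of_mem_nhds
      (Gamma_mem_nhds_of_conj_isometry f h g hfg hδ x), hnull x⟩
  exact NeZero.ne μ (Measure.measure_univ_eq_zero.1 huniv)

/-- Rotation of the circle preserves distances. -/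
theorem Circle.isometry_mul_left (a : Circle) : Isometry fun z : Circle => a * z :=
  Isometry.of_dist_eq fun z w => by
    change dist ((a : ℂ) * z) (a * w) = dist (z : ℂ) w
    rw [dist_eq_norm, dist_eq_norm]
    rw [← mul_sub, norm_mul, Circle.norm_coe, one_mul]

theorem measureExpansive_circle_not_conj_rotation (f : Circle ≃ₜ Circle)
    (μ : Measure Circle) [IsProbabilityMeasure μ]
    (hf : MeasureExpansive μ f.toEquiv) :
    ¬ ∃ (h : Circle ≃ₜ Circle) (a : Circle), ∀ z : Circle, f z = h (a * h.symm z) := by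
  rintro ⟨h, a, hfa⟩
  exact hf.not_conj_isometry h ⟨Equiv.mulLeft a, Circle.isometry_mul_left a⟩ hfa
end

section
/- Let X be a separable metric space, f : X → X a surjective isometry, and μ a Borel probability measure on X. Then f is not μ-expansive. -/
open MeasureTheory Set Filter

theorem dist_zpow_apply_of_isometry {X : Type*} [MetricSpace X] {f : Equiv.Perm X}
    (hf : Isometry ⇑f) (n : ℤ) (x y : X) :
    dist ((f ^ n) x) ((f ^ n) y) = dist x y := by
  induction n generalizing x y with
  | zero => simp
  | succ n ih =>
    rw [zpow_add_one, Equiv.Perm.mul_apply, Equiv.Perm.mul_apply, ih, hf.dist_eq]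
  | pred n ih =>
    rw [zpow_sub_one, Equiv.Perm.mul_apply, Equiv.Perm.mul_apply, ih, ← hf.dist_eq,
      ← Equiv.Perm.mul_apply, ← Equiv.Perm.mul_apply, mul_inv_cancel, Equiv.Perm.one_apply,
      Equiv.Perm.one_apply]

theorem Gamma_eq_closedBall_of_isometry {X : Type*} [MetricSpace X] {f : Equiv.Perm X}
    (hf : Isometry ⇑f) (δ : ℝ) (x : X) : Gamma f δ x = Metric.closedBall x δ := by
  ext y
  simp [Gamma, dist_zpow_apply_of_isometry hf, dist_comm x y]

theorem no_measureExpansive_isometry {X : Type*} [MetricSpace X]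
    [TopologicalSpace.SeparableSpace X] [MeasurableSpace X] [BorelSpace X]
    (f : Equiv.Perm X) (hf : Isometry ⇑f)
    (μ : Measure X) [IsProbabilityMeasure μ] :
    ¬ MeasureExpansive μ f := by
  rintro ⟨δ, hδ, h⟩
  obtain ⟨s, hs, hd⟩ := TopologicalSpace.exists_countable_dense X
  have hcover : (⋃ x ∈ s, Gamma f δ x) = univ := by
    refine eq_univ_of_forall fun y => ?_
    obtain ⟨x, hx, hxy⟩ := hd.exists_dist_lt y hδ
    refine mem_biUnion hx ?_
    rw [Gamma_eq_closedBall_of_isometry hf]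
    exact hxy.le
  have hnull : μ (⋃ x ∈ s, Gamma f δ x) = 0 :=
    (measure_biUnion_null_iff hs).2 fun x _ => h x
  rw [hcover, measure_univ] at hnull
  exact one_ne_zero hnull
end

section
/- Let X and Y be compact metric spaces, μ a Borel probability measure on X, f : X → X a μ-expansive homeomorphism, and φ : X → Y a homeomorphism. Then φ ∘ f ∘ φ⁻¹ : Y → Y is a φ_*(μ)-expansive homeomorphism, where φ_*(μ) is the pushforward measure defined by φ_*(μ)(A) = μ(φ⁻¹(A)) for every Borel set A ⊆ Y. -/
open MeasureTheory Set Filter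

/-- Iterates of a conjugated permutation are the conjugated iterates. -/
theorem permCongr_zpow_apply {X Y : Type*} (φ : X ≃ Y) (f : Equiv.Perm X) (n : ℤ) (x : X) :
    (φ.permCongr f ^ n) (φ x) = φ ((f ^ n) x) := by
  have h : φ.permCongr f ^ n = φ.permCongr (f ^ n) := (map_zpow φ.permCongrHom f n).symm
  simp [h, Equiv.permCongr_apply]

/-- If `δ'`-closeness in `Y` pulls back to `δ`-closeness in `X`, then the `δ'`-orbit set of a
conjugated map pulls back into the `δ`-orbit set of the original map. -/
theorem preimage_Gamma_permCongr_subset {X Y : Type*} [MetricSpace X] [MetricSpace Y]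
    (φ : X ≃ Y) (f : Equiv.Perm X) {δ δ' : ℝ}
    (h : ∀ a b : X, dist (φ a) (φ b) ≤ δ' → dist a b ≤ δ) (y : Y) :
    φ ⁻¹' Gamma (φ.permCongr f) δ' y ⊆ Gamma f δ (φ.symm y) := by
  intro x hx n
  apply h
  rw [← permCongr_zpow_apply, ← permCongr_zpow_apply, φ.apply_symm_apply]
  exact hx n

theorem measureExpansive_conjugacy {X Y : Type*}
    [MetricSpace X] [CompactSpace X] [MeasurableSpace X] [BorelSpace X]
    [MetricSpace Y] [CompactSpace Y] [MeasurableSpace Y] [BorelSpace Y]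
    (μ : Measure X) [IsProbabilityMeasure μ]
    (f : X ≃ₜ X) (hf : MeasureExpansive μ f.toEquiv) (φ : X ≃ₜ Y) :
    MeasureExpansive (μ.map ⇑φ) (φ.symm.trans (f.trans φ)).toEquiv := by
  obtain ⟨δ, hδ, hμ⟩ := hf
  obtain ⟨ε, hε, hφ⟩ := Metric.uniformContinuous_iff.mp
    (CompactSpace.uniformContinuous_of_continuous φ.symm.continuous) δ hδ
  refine ⟨ε / 2, half_pos hε, fun y => ?_⟩
  change μ.map φ.toMeasurableEquiv _ = 0
  rw [φ.toMeasurableEquiv.map_apply]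
  refine measure_mono_null (preimage_Gamma_permCongr_subset φ.toEquiv f.toEquiv
    (fun a b hab => ?_) y) (hμ _)
  have := hφ (a := φ a) (b := φ b) (hab.trans_lt (half_lt_self hε))
  simpa using this.le
end

section
/- Let S¹ be the unit circle in the complex plane with the induced metric. There is no expansive homeomorphism f : S¹ → S¹. -/
open MeasureTheory Set Filter

/-- `f` is expansive. -/
def Expansive {X : Type*} [MetricSpace X] (f : Equiv.Perm X) : Prop :=
  ∃ δ > (0 : ℝ), ∀ x : X, Gamma f δ x = {x}

open unitInterval

section Dynamics

variable {X : Type*} [MetricSpace X] {f : Equiv.Perm X}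

lemma exists_dist_zpow_le (hf : ∀ n : ℤ, Continuous (f ^ n)) {γ : I → X} (hγ : Continuous γ)
    {δ : ℝ} (hδ : 0 < δ) {S : Set ℤ} (hS : S.Finite) {a b : I} (hab : a < b) :
    ∃ c, a < c ∧ c ≤ b ∧ ∀ n ∈ S, dist ((f ^ n) (γ a)) ((f ^ n) (γ c)) ≤ δ := by
  have near : ∀ᶠ c in nhds a, ∀ n ∈ S, dist ((f ^ n) (γ a)) ((f ^ n) (γ c)) < δ := by
    rw [Filter.eventually_all_finite hS]
    intro n _
    have hc : Continuous fun c => dist ((f ^ n) (γ a)) ((f ^ n) (γ c)) :=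
      continuous_const.dist ((hf n).comp hγ)
    exact hc.continuousAt.eventually_lt_const (by simpa using hδ)
  have : (nhdsWithin a (Ioi a)).NeBot := nhdsGT_neBot_of_exists_gt ⟨b, hab⟩
  obtain ⟨c, hc, hac, hcb⟩ :=
    ((near.filter_mono nhdsWithin_le_nhds).and (Ioc_mem_nhdsGT hab)).exists
  exact ⟨c, hac, hcb, fun n hn => (hc n hn).le⟩

/-- The iterates of an arc under an expansive map have diameter exceeding the expansivity constant
infinitely often. -/
lemma infinite_setOf_lt_dist_zpow (hf : ∀ n : ℤ, Continuous (f ^ n)) {γ : I → X}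
    (hγ : Continuous γ) (hinj : Function.Injective γ) {δ : ℝ} (hδ : 0 < δ)
    (hΓ : ∀ x, Gamma f δ x = {x}) {a b : I} (hab : a < b) :
    {n : ℤ | ∃ x ∈ (f ^ n) '' (γ '' Icc a b), ∃ y ∈ (f ^ n) '' (γ '' Icc a b),
      δ < dist x y}.Infinite := by
  intro hfin
  obtain ⟨c, hac, hcb, hc⟩ := exists_dist_zpow_le hf hγ hδ hfin hab
  have hmem : γ c ∈ Gamma f δ (γ a) := by
    intro n
    by_contra! hn
    exact hn.not_ge (hc n ⟨_, mem_image_of_mem _ (mem_image_of_mem _ ⟨le_rfl, hab.le⟩), _,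
      mem_image_of_mem _ (mem_image_of_mem _ ⟨hac.le, hcb⟩), hn⟩)
  rw [hΓ] at hmem
  exact hac.ne' (hinj hmem)

lemma exists_infinite_range_subset {ι : Type*} [Finite ι] {γ : ι → I → X} {J : Set X} {δ : ℝ}
    (hf : ∀ n : ℤ, Continuous (f ^ n))
    (hcover : ∀ C : Set X, IsPreconnected C → (∃ x ∈ C, ∃ y ∈ C, δ < dist x y) →
      ∃ i, range (γ i) ⊆ C) (hJ : IsPreconnected J)
    (hbig : {n : ℤ | ∃ x ∈ (f ^ n) '' J, ∃ y ∈ (f ^ n) '' J, δ < dist x y}.Infinite) :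
    ∃ j, {n : ℤ | range (γ j) ⊆ (f ^ n) '' J}.Infinite := by
  by_contra! h
  refine hbig ((Set.finite_iUnion h).subset fun n hn => ?_)
  exact mem_iUnion.2 (hcover _ (hJ.image _ (hf n).continuousOn) hn)

/-- A continuous injective self-map of the interval squares to the identity or moves some
subinterval off itself under all positive iterates of its square. -/
lemma exists_Icc_disjoint_iterate {u : I → I} (hu : Continuous u) (hinj : Function.Injective u)
    (hne : ∃ t, u (u t) ≠ t) :
    ∃ a b : I, a < b ∧ ∀ k, 0 < k → ∀ s ∈ Icc a b, (u ∘ u)^[k] s ∉ Icc a b := by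
  have hmono : Monotone (u ∘ u) := by
    rcases hu.strictMono_of_inj hinj with h | h
    · exact (h.comp h).monotone
    · exact (h.comp h).monotone
  obtain ⟨t, ht⟩ := hne
  rcases lt_or_gt_of_ne ht with h | h
  · obtain ⟨c, hvc, hct⟩ := exists_between h
    refine ⟨c, t, hct, fun k hk s hs hs' => ?_⟩
    have h1 := hmono.iterate k hs.2
    have h2 := hmono.antitone_iterate_of_map_le h.le (Nat.succ_le_of_lt hk)
    exact (hs'.1.trans (h1.trans h2)).not_gt hvc
  · obtain ⟨c, htc, hcv⟩ := exists_between h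
    refine ⟨t, c, htc, fun k hk s hs hs' => ?_⟩
    have h1 := hmono.iterate k hs.1
    have h2 := hmono.monotone_iterate_of_le_map h.le (Nat.succ_le_of_lt hk)
    exact ((h2.trans h1).trans hs'.2).not_gt hcv

lemma not_forall_zpow_apply_eq (hf : ∀ n : ℤ, Continuous (f ^ n)) {γ : I → X}
    (hγ : Continuous γ) (hinj : Function.Injective γ) {δ : ℝ} (hδ : 0 < δ)
    (hΓ : ∀ x, Gamma f δ x = {x}) {N : ℤ} (hN : N ≠ 0) : ¬ ∀ t, (f ^ N) (γ t) = γ t := by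
  intro hid
  obtain ⟨c, hc, -, hclose⟩ := exists_dist_zpow_le hf hγ hδ (Set.finite_Ico 0 |N|) zero_lt_one
  have hmod : ∀ (m : ℤ) t, (f ^ m) (γ t) = (f ^ (m % N)) (γ t) := fun m t => by
    conv_lhs => rw [← Int.emod_add_mul_ediv m N, zpow_add, Equiv.Perm.mul_apply, zpow_mul]
    rw [Function.IsFixedPt.perm_zpow (hid t)]
  have hmem : γ c ∈ Gamma f δ (γ 0) := fun m => by
    rw [hmod, hmod m c]
    exact hclose _ ⟨Int.emod_nonneg m hN, Int.emod_lt_abs m hN⟩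
  rw [hΓ] at hmem
  exact hc.ne' (hinj hmem)

lemma not_mapsTo_range {ι : Type*} [Finite ι] {γ : ι → I → X}
    (hf : ∀ n : ℤ, Continuous (f ^ n)) (hγ : ∀ i, Continuous (γ i))
    (hinj : ∀ i, Function.Injective (γ i)) {δ : ℝ} (hδ : 0 < δ)
    (hcover : ∀ C : Set X, IsPreconnected C → (∃ x ∈ C, ∃ y ∈ C, δ < dist x y) →
      ∃ i, range (γ i) ⊆ C)
    (hΓ : ∀ x, Gamma f δ x = {x}) {n : ℤ} (hn : n ≠ 0) (i : ι) :
    ¬ MapsTo (f ^ n) (range (γ i)) (range (γ i)) := by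
  intro hmaps
  have hex : ∀ t, ∃ s, γ i s = (f ^ n) (γ i t) := fun t => hmaps (mem_range_self t)
  choose u hu using hex
  have hucont : Continuous u := by
    rw [((hγ i).isClosedEmbedding (hinj i)).continuous_iff]
    exact ((hf n).comp (hγ i)).congr fun t => (hu t).symm
  have huinj : Function.Injective u := fun s t hst => by
    apply hinj i
    apply (f ^ n).injective
    rw [← hu, ← hu, hst]
  have hu2 : ∀ t, (f ^ (n + n)) (γ i t) = γ i ((u ∘ u) t) := fun t => by
    rw [zpow_add, Equiv.Perm.mul_apply, ← hu, ← hu, Function.comp_apply]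
  have hnn : n + n ≠ 0 := by lia
  have hiter : ∀ (k : ℕ) t, (f ^ ((n + n) * k)) (γ i t) = γ i ((u ∘ u)^[k] t) := by
    intro k
    induction k with
    | zero => simp
    | succ k ih =>
      intro t
      rw [Nat.cast_succ, mul_add, mul_one, zpow_add, Equiv.Perm.mul_apply, hu2, ih,
        Function.iterate_succ_apply]
  by_cases hne : ∃ t, u (u t) ≠ t
  · obtain ⟨a, b, hab, hdisj⟩ := exists_Icc_disjoint_iterate hucont huinj hne
    obtain ⟨j, hj⟩ := exists_infinite_range_subset hf hcover
      (isPreconnected_Icc.image _ (hγ i).continuousOn)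
      (infinite_setOf_lt_dist_zpow hf (hγ i) (hinj i) hδ hΓ hab)
    obtain ⟨m, hm, m', hm', hmm, hmod⟩ := hj.exists_ne_map_eq_of_mapsTo (f := (· % (n + n)))
      (t := Ico 0 |n + n|) (fun m _ => ⟨Int.emod_nonneg m hnn, Int.emod_lt_abs m hnn⟩) (Set.finite_Ico 0 |n + n|)
    have key : ∀ p q : ℤ, range (γ j) ⊆ (f ^ p) '' (γ i '' Icc a b) →
        range (γ j) ⊆ (f ^ q) '' (γ i '' Icc a b) → ∀ k : ℕ, 0 < k → p - q ≠ (n + n) * k := by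
      intro p q hp hq k hk hpq
      obtain ⟨_, ⟨s, hs, rfl⟩, hs'⟩ := hp (mem_range_self 0)
      obtain ⟨_, ⟨s₂, hs₂, rfl⟩, hs₂'⟩ := hq (mem_range_self 0)
      have h1 : (f ^ ((n + n) * k)) (γ i s) = γ i s₂ := by
        apply (f ^ q).injective
        rw [← Equiv.Perm.mul_apply, ← zpow_add, ← hpq, add_sub_cancel, hs', hs₂']
      rw [hiter] at h1
      exact hdisj k hk s hs (hinj i h1 ▸ hs₂)
    obtain ⟨k, hk⟩ := Int.ModEq.dvd (show m' ≡ m [ZMOD (n + n)] from hmod.symm)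
    rcases lt_trichotomy k 0 with hk0 | hk0 | hk0
    · lift -k to ℕ using by lia with l hl
      exact key m' m hm' hm l (by lia) (by rw [hl]; linear_combination -hk)
    · exact hmm (by rw [hk0, mul_zero] at hk; lia)
    · lift k to ℕ using hk0.le
      exact key m m' hm hm' k (by lia) hk
  · push Not at hne
    exact not_forall_zpow_apply_eq hf (hγ i) (hinj i) hδ hΓ hnn fun t => by
      rw [hu2, Function.comp_apply, hne]

/-- If finitely many arcs are such that each connected set of diameter greater than `δ` contains
one of them, then `δ` is not an expansivity constant. -/
theorem not_forall_Gamma_eq_singleton {ι : Type*} [Finite ι] [Nonempty ι] {γ : ι → I → X}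
    (hf : ∀ n : ℤ, Continuous (f ^ n)) (hγ : ∀ i, Continuous (γ i))
    (hinj : ∀ i, Function.Injective (γ i)) {δ : ℝ} (hδ : 0 < δ)
    (hcover : ∀ C : Set X, IsPreconnected C → (∃ x ∈ C, ∃ y ∈ C, δ < dist x y) →
      ∃ i, range (γ i) ⊆ C) :
    ¬ ∀ x, Gamma f δ x = {x} := by
  intro hΓ
  let R : ι → ι → Prop := fun j i => {n : ℤ | range (γ j) ⊆ (f ^ n) '' range (γ i)}.Infinite
  have hserial : ∀ i, ∃ j, R j i := fun i => by
    refine exists_infinite_range_subset hf hcover (isPreconnected_range (hγ i)) ?_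
    have := infinite_setOf_lt_dist_zpow hf (hγ i) (hinj i) hδ hΓ (zero_lt_one (α := I))
    rwa [unitInterval.univ_eq_Icc.symm, image_univ] at this
  have htrans : IsTrans ι R := ⟨fun k j i hkj hji => by
    obtain ⟨m, hm⟩ := hkj.nonempty
    refine (hji.image (add_right_injective m).injOn).mono ?_
    rintro _ ⟨n, hn, rfl⟩
    simp only [mem_ofPred_eq] at hm hn ⊢
    rw [zpow_add, Equiv.Perm.coe_mul, image_comp]
    exact hm.trans (image_mono hn)⟩
  have hirrefl : Std.Irrefl R := ⟨fun i hi => by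
    obtain ⟨n, hn, hn0⟩ := hi.exists_notMem_finite (Set.finite_singleton 0)
    refine not_mapsTo_range hf hγ hinj hδ hcover hΓ (neg_ne_zero.2 hn0) i fun x hx => ?_
    obtain ⟨y, hy, rfl⟩ := hn hx
    simpa [zpow_neg] using hy⟩
  obtain ⟨i, -, hi⟩ := (Finite.wellFounded_of_trans_of_irrefl R).has_min univ univ_nonempty
  obtain ⟨j, hj⟩ := hserial i
  exact hi j (mem_univ j) hj

end Dynamics

lemma Circle.dist_exp_exp_le (s t : ℝ) : dist (Circle.exp s) (Circle.exp t) ≤ |s - t| := by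
  have h : Complex.exp (s * Complex.I) - Complex.exp (t * Complex.I) =
      Complex.exp (t * Complex.I) * (Complex.exp (Complex.I * (s - t : ℝ)) - 1) := by
    rw [mul_sub, ← Complex.exp_add, mul_one]
    push_cast
    ring_nf
  change dist (Circle.exp s : ℂ) (Circle.exp t) ≤ _
  rw [Circle.coe_exp, Circle.coe_exp, dist_eq_norm, h, norm_mul,
    Complex.norm_exp_ofReal_mul_I, one_mul]
  exact Real.norm_exp_I_mul_ofReal_sub_one_le

/-- A connected subset of the circle with two points at distance more than `δ` contains
the image of an interval of length more than `δ`. -/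
lemma Circle.exists_exp_image_Icc_subset {C : Set Circle} (hC : IsPreconnected C) {δ : ℝ}
    {x y : Circle} (hx : x ∈ C) (hy : y ∈ C) (hxy : δ < dist x y) :
    ∃ s t : ℝ, -(2 * Real.pi) ≤ s ∧ t ≤ 2 * Real.pi ∧ s + δ < t ∧ Circle.exp '' Icc s t ⊆ C := by
  by_cases huniv : C = univ
  · refine ⟨-(2 * Real.pi), 2 * Real.pi, le_rfl, le_rfl, ?_, by simp [huniv]⟩
    have h := Circle.dist_exp_exp_le (x : ℂ).arg (y : ℂ).arg
    rw [Circle.exp_arg, Circle.exp_arg] at h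
    have := abs_sub (x : ℂ).arg (y : ℂ).arg
    linarith [Complex.abs_arg_le_pi x, Complex.abs_arg_le_pi y, Real.pi_pos]
  obtain ⟨p, hp⟩ := (ne_univ_iff_exists_notMem C).1 huniv
  let θ : ℝ := ((-p : Circle) : ℂ).arg
  let g : Circle → ℝ := fun z => ((z / -p : Circle) : ℂ).arg
  have hexp : ∀ z, Circle.exp (g z + θ) = z := fun z => by
    rw [Circle.exp_add, Circle.exp_arg, Circle.exp_arg, div_mul_cancel]
  have hg : ContinuousOn g C := by
    intro z hz
    apply ContinuousAt.continuousWithinAt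
    have hslit : ((z / -p : Circle) : ℂ) ∈ Complex.slitPlane := by
      rw [Complex.mem_slitPlane_iff_arg]
      refine ⟨fun h => hp ?_, Circle.coe_ne_zero _⟩
      have h1 : (z / -p : Circle) = -1 :=
        Circle.injective_arg (h.trans Complex.arg_neg_one.symm)
      rw [div_eq_iff_eq_mul] at h1
      simpa [h1] using hz
    have hcont : Continuous fun z : Circle => ((z / -p : Circle) : ℂ) := by fun_prop
    exact ContinuousAt.comp (f := fun z : Circle => ((z / -p : Circle) : ℂ))
      (Complex.continuousAt_arg hslit) hcont.continuousAt
  have hord := (hC.image g hg).ordConnected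
  have hbig := Circle.dist_exp_exp_le (g x + θ) (g y + θ)
  rw [hexp, hexp, add_sub_add_right_eq_sub] at hbig
  have main : ∀ z ∈ C, ∀ w ∈ C, g z + δ < g w → ∃ s t : ℝ, -(2 * Real.pi) ≤ s ∧
      t ≤ 2 * Real.pi ∧ s + δ < t ∧ Circle.exp '' Icc s t ⊆ C := by
    intro z hz w hw hzw
    have h1 : -Real.pi < g z := Complex.neg_pi_lt_arg _
    have h2 : g w ≤ Real.pi := Complex.arg_le_pi _
    have h3 : -Real.pi < θ := Complex.neg_pi_lt_arg _
    have h4 : θ ≤ Real.pi := Complex.arg_le_pi _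
    refine ⟨g z + θ, g w + θ, by linarith, by linarith, by linarith, ?_⟩
    rintro _ ⟨r, ⟨hr1, hr2⟩, rfl⟩
    obtain ⟨v, hv, hvr⟩ := hord.out (mem_image_of_mem g hz) (mem_image_of_mem g hw)
      (show r - θ ∈ Icc (g z) (g w) from ⟨by linarith, by linarith⟩)
    rw [← sub_add_cancel r θ, ← hvr, hexp]
    exact hv
  rcases le_abs'.1 (hxy.le.trans hbig) with h | h
  all_goals rcases lt_abs.1 (hxy.trans_le hbig) with h' | h'
  all_goals first
    | exact main x hx y hy (by linarith)
    | exact main y hy x hx (by linarith)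

theorem no_expansive_homeo_circle (f : Circle ≃ₜ Circle) :
    ¬ Expansive f.toEquiv := by
  rintro ⟨δ, hδ, hΓ⟩
  have hf : ∀ n : ℤ, Continuous (f.toEquiv ^ n) := by
    have hpow : ∀ n : ℕ, Continuous (f.toEquiv ^ n) ∧ Continuous (f.toEquiv ^ n).symm := by
      intro n
      induction n with
      | zero => exact ⟨continuous_id, continuous_id⟩
      | succ n ih =>
        rw [pow_succ]
        exact ⟨ih.1.comp f.continuous, f.symm.continuous.comp ih.2⟩
    intro n
    obtain ⟨m, rfl | rfl⟩ := n.eq_nat_or_neg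
    · simpa using (hpow m).1
    · rw [zpow_neg, zpow_natCast]
      exact (hpow m).2
  have hπ := Real.pi_pos
  obtain ⟨η, hη, hηδ, hηπ⟩ : ∃ η : ℝ, 0 < η ∧ 2 * η ≤ δ ∧ η < 2 * Real.pi :=
    ⟨min (δ / 2) 1, by positivity, by linarith [min_le_left (δ / 2) 1],
      by linarith [min_le_right (δ / 2) 1, Real.pi_gt_three]⟩
  let N : ℤ := ⌈2 * Real.pi / η⌉
  have hN : 2 * Real.pi ≤ N * η := (div_le_iff₀ hη).1 (Int.le_ceil _)
  have hN0 : 0 ≤ N := Int.ceil_nonneg (by positivity)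
  let γ : Icc (-N) N → I → Circle := fun j t => Circle.exp ((j + t) * η)
  have : Nonempty (Icc (-N) N) := ⟨⟨0, by simpa using hN0⟩⟩
  refine not_forall_Gamma_eq_singleton (γ := γ) hf (fun j => by fun_prop) ?_ hδ ?_ hΓ
  · intro j s t hst
    have h := Circle.exp_injOn_Icc (a := j * η) (b := (j + 1) * η) (by linarith)
      (show ((j : ℝ) + s) * η ∈ _ from ⟨by nlinarith [s.2.1], by nlinarith [s.2.2]⟩)
      (show ((j : ℝ) + t) * η ∈ _ from ⟨by nlinarith [t.2.1], by nlinarith [t.2.2]⟩) hst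
    exact Subtype.ext (add_left_cancel (mul_right_cancel₀ hη.ne' h))
  · rintro C hC ⟨x, hx, y, hy, hxy⟩
    obtain ⟨s, t, hs, ht, hst, hsub⟩ := Circle.exists_exp_image_Icc_subset hC hx hy hxy
    have h1 : s ≤ ⌈s / η⌉ * η := (div_le_iff₀ hη).1 (Int.le_ceil _)
    have h2 : ⌈s / η⌉ * η < s + η := by
      have := mul_lt_mul_of_pos_right (Int.ceil_lt_add_one (s / η)) hη
      rwa [add_mul, one_mul, div_mul_cancel₀ _ hη.ne'] at this
    refine ⟨⟨⌈s / η⌉, ?_, ?_⟩, ?_⟩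
    · have : (-N : ℝ) ≤ ⌈s / η⌉ := le_of_mul_le_mul_right (by linarith) hη
      exact_mod_cast this
    · have : (⌈s / η⌉ : ℝ) ≤ N := le_of_mul_le_mul_right (by linarith) hη
      exact_mod_cast this
    · rintro _ ⟨r, rfl⟩
      refine hsub (mem_image_of_mem _ ⟨?_, ?_⟩) <;> simp only
      · nlinarith [r.2.1]
      · nlinarith [r.2.2]
end

section
/- Let X be a compact metric space, f : X → X a continuous map and μ a Borel probability measure on X. If there exist δ > 0 and ρ > 0 such that for every x ∈ X one has limsup_{n→∞} −log(μ(B_f[x,δ,n]))/n ≥ ρ (with the convention −log 0 = ∞), then f is positively μ-expansive. -/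
open MeasureTheory Set Filter

/-- `B_f[x,δ,n] = {y : d(fⁱx, fⁱy) ≤ δ for all 0 ≤ i < n}`. -/
def Bset {X : Type*} [MetricSpace X] (f : X → X) (x : X) (δ : ℝ) (n : ℕ) : Set X :=
  {y | ∀ i : ℕ, i < n → dist (f^[i] x) (f^[i] y) ≤ δ}

/-- `Φ_δ(x)`: points whose forward orbit stays `δ`-close to that of `x`. -/
def Phi {X : Type*} [MetricSpace X] (f : X → X) (δ : ℝ) (x : X) : Set X :=
  {y | ∀ i : ℕ, dist (f^[i] x) (f^[i] y) ≤ δ}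

/-- `f` is positively `μ`-expansive. -/
def PosMeasureExpansive {X : Type*} [MetricSpace X] [MeasurableSpace X]
    (μ : Measure X) (f : X → X) : Prop :=
  ∃ δ > (0 : ℝ), ∀ x : X, μ (Phi f δ x) = 0

theorem Phi_subset_Bset {X : Type*} [MetricSpace X] (f : X → X) (δ : ℝ) (x : X) (n : ℕ) :
    Phi f δ x ⊆ Bset f x δ n :=
  fun _ hy i _ => hy i

theorem posMeasureExpansive_of_positive_entropy {X : Type*} [MetricSpace X] [CompactSpace X]
    [MeasurableSpace X] [BorelSpace X] (μ : Measure X) [IsProbabilityMeasure μ]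
    (f : X → X) (hf : Continuous f)
    (h : ∃ δ > (0 : ℝ), ∃ ρ > (0 : ℝ), ∀ x : X,
      (ρ : EReal) ≤ Filter.limsup
        (fun n : ℕ => (-(ENNReal.log (μ (Bset f x δ n)))) * (((n : ℝ)⁻¹ : ℝ) : EReal))
        Filter.atTop) :
    PosMeasureExpansive μ f := by
  obtain ⟨δ, hδ, ρ, hρ, h⟩ := h
  refine ⟨δ, hδ, fun x => ?_⟩
  by_contra hc
  obtain ⟨r, hr⟩ : ∃ r : ℝ, (r : EReal) = -(ENNReal.log (μ (Phi f δ x))) := by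
    refine ⟨_, EReal.coe_toReal ?_ ?_⟩ <;>
      simp [EReal.neg_eq_top_iff, EReal.neg_eq_bot_iff, hc]
  have hlim : Tendsto (fun n : ℕ => ((r * (n : ℝ)⁻¹ : ℝ) : EReal)) atTop (nhds 0) := by
    rw [← EReal.coe_zero, EReal.tendsto_coe]
    simpa using tendsto_inv_atTop_nhds_zero_nat.const_mul r
  have hle := (h x).trans <| (limsup_le_limsup (Eventually.of_forall fun n : ℕ => by
    rw [EReal.coe_mul, hr]
    refine mul_le_mul_of_nonneg_right ?_ (EReal.coe_nonneg.2 (by positivity))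
    exact EReal.neg_le_neg_iff.2
      (ENNReal.log_monotone (measure_mono (Phi_subset_Bset f δ x n))))).trans hlim.limsup_eq.le
  exact absurd hle (not_le.2 (EReal.coe_pos.2 hρ))
end
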